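/- Let H̄=(H0,H1) be a compatible pair of complex Hilbert spaces, θ0,θ1∈[0,1], and for j=0,1 let ℋ_j = K_{θ_j,2}(H̄) (with its K-norm, normalisation N_{θ,2}=((2/π)sin(πθ))^{1/2}) if 0<θ_j<1, and ℋ_j=H_{θ_j} if θ_j∈{0,1}. Then (ℋ0,ℋ1) is a compatible pair, and for every 0<η<1, writing θ=(1−η)θ0+ηθ1, it holds that K_{η,2}((ℋ0,ℋ1)) = K_{θ,2}(H̄) as sets, with equal norms (where K_{θ,2}(H̄) is interpreted as H_θ with its own norm if θ∈{0,1}). -/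

import Mathlib

open MeasureTheory Set Filter Topology
open scoped ENNReal NNReal

noncomputable section

/-- The measure `dt/t` on `(0,∞)`. -/
def logMeasure : Measure ℝ :=
  (volume.restrict (Set.Ioi (0:ℝ))).withDensity (fun t => ENNReal.ofReal t⁻¹)

/-- The weighted norm `‖F‖_{θ,q} = (∫₀^∞ (t^{-θ} F(t))^q dt/t)^{1/q}`,
with the essential supremum convention for `q = ∞`. -/
def thetaNormE (θ : ℝ) (q : ℝ≥0∞) (F : ℝ → ℝ≥0∞) : ℝ≥0∞ :=
  if q = ⊤ then essSup (fun t => ENNReal.ofReal (t ^ (-θ)) * F t) logMeasure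
  else (∫⁻ t, (ENNReal.ofReal (t ^ (-θ)) * F t) ^ q.toReal ∂logMeasure) ^ (1 / q.toReal)

/-- `g(s) = s/√(1+s²)`. -/
def gfun (s : ℝ) : ℝ := s / Real.sqrt (1 + s ^ 2)

def gfunE (s : ℝ) : ℝ≥0∞ := ENNReal.ofReal (gfun s)

/-- A compatible pair of complex Banach spaces: `X0` and `X1` are complex Banach
spaces realised as linear subspaces (via injective linear maps) of a common
complex vector space `V`. -/
structure CompatiblePair (V : Type*) [AddCommGroup V] [Module ℂ V]
    (X0 : Type*) [NormedAddCommGroup X0] [NormedSpace ℂ X0] [CompleteSpace X0]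
    (X1 : Type*) [NormedAddCommGroup X1] [NormedSpace ℂ X1] [CompleteSpace X1] where
  j0 : X0 →ₗ[ℂ] V
  j1 : X1 →ₗ[ℂ] V
  inj0 : Function.Injective j0
  inj1 : Function.Injective j1

namespace CompatiblePair

variable {V X0 X1 : Type*} [AddCommGroup V] [Module ℂ V]
  [NormedAddCommGroup X0] [NormedSpace ℂ X0] [CompleteSpace X0]
  [NormedAddCommGroup X1] [NormedSpace ℂ X1] [CompleteSpace X1]
  (P : CompatiblePair V X0 X1)

/-- `Σ(X̄) = X0 + X1` as a subset of `V`. -/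
def sigmaSet : Set V := {x | ∃ a b, P.j0 a + P.j1 b = x}

/-- `Δ(X̄) = X0 ∩ X1` as a subset of `V`. -/
def deltaSet : Set V := Set.range P.j0 ∩ Set.range P.j1

/-- `‖x‖_{Σ(X̄)}` (with value `∞` off `Σ(X̄)`). -/
def normSigmaE (x : V) : ℝ≥0∞ :=
  sInf {r | ∃ a b, P.j0 a + P.j1 b = x ∧ r = ENNReal.ofReal (‖a‖ + ‖b‖)}

/-- `‖x‖_{Δ(X̄)} = max(‖x‖_{X0}, ‖x‖_{X1})` (with value `∞` off `Δ(X̄)`). -/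
def normDeltaE (x : V) : ℝ≥0∞ :=
  sInf {r | ∃ a b, P.j0 a = x ∧ P.j1 b = x ∧ r = ENNReal.ofReal (max ‖a‖ ‖b‖)}

/-- `‖x‖_{X0}` for `x` in (the image of) `X0` (with value `∞` otherwise). -/
def norm0E (x : V) : ℝ≥0∞ := sInf {r | ∃ a, P.j0 a = x ∧ r = ENNReal.ofReal ‖a‖}

/-- `‖x‖_{X1}` for `x` in (the image of) `X1` (with value `∞` otherwise). -/
def norm1E (x : V) : ℝ≥0∞ := sInf {r | ∃ b, P.j1 b = x ∧ r = ENNReal.ofReal ‖b‖}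

/-- The K-functional `K(t,x) = inf {(‖a‖_{X0}² + t²‖b‖_{X1}²)^{1/2} : j0 a + j1 b = x}`. -/
def KfunE (t : ℝ) (x : V) : ℝ≥0∞ :=
  sInf {r | ∃ a b, P.j0 a + P.j1 b = x ∧
    r = ENNReal.ofReal (Real.sqrt (‖a‖ ^ 2 + t ^ 2 * ‖b‖ ^ 2))}

/-- `‖K(·,x)‖_{θ,q}`. -/
def KquasinormE (θ : ℝ) (q : ℝ≥0∞) (x : V) : ℝ≥0∞ := thetaNormE θ q (fun t => P.KfunE t x)

/-- The underlying set of the interpolation space `K_{θ,q}(X̄)`. -/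
def Kmem (θ : ℝ) (q : ℝ≥0∞) : Set V := {x | x ∈ P.sigmaSet ∧ P.KquasinormE θ q x < ⊤}

/-- The norm of `K_{θ,q}(X̄)`, with the normalisation `N_{θ,q} = ‖g‖_{θ,q}⁻¹`,
`g(s) = s/√(1+s²)`. -/
def KnormE (θ : ℝ) (q : ℝ≥0∞) (x : V) : ℝ≥0∞ :=
  (thetaNormE θ q gfunE)⁻¹ * P.KquasinormE θ q x

/-- The norm of `K_{θ,2}(X̄)`, with the explicit normalisation
`N_{θ,2} = ((2/π) sin (πθ))^{1/2}`. -/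
def Knorm2E (θ : ℝ) (x : V) : ℝ≥0∞ :=
  ENNReal.ofReal (Real.sqrt (2 / Real.pi * Real.sin (Real.pi * θ))) * P.KquasinormE θ 2 x

/-- The real-valued `K_{θ,2}` norm. -/
def Knorm2R (θ : ℝ) (x : V) : ℝ := (P.Knorm2E θ x).toReal

/-- `Δ(X̄)` realised as a (normed) submodule of `X0 × X1` (with the max norm):
pairs `(a,b)` with `j0 a = j1 b`. -/
def deltaSub : Submodule ℂ (X0 × X1) where
  carrier := {p | P.j0 p.1 = P.j1 p.2}
  add_mem' := by
    intro p q hp hq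
    simp only [Set.mem_setOf_eq] at *
    simp [map_add, hp, hq]
  zero_mem' := by simp
  smul_mem' := by
    intro c p hp
    simp only [Set.mem_setOf_eq] at *
    simp [_root_.map_smul, hp]

/-- The J-functional `J(t,φ) = (‖φ‖_{X0}² + t²‖φ‖_{X1}²)^{1/2}`. -/
def Jfun (t : ℝ) (p : X0 × X1) : ℝ := Real.sqrt (‖p.1‖ ^ 2 + t ^ 2 * ‖p.2‖ ^ 2)

/-- `f : (0,∞) → Δ(X̄)` is a J-representation of `φ`: it is strongly measurable,
`∫_a^b ‖f(t)‖_Δ dt/t < ∞` for `0<a<b<∞`, `∫₀^∞ ‖f(t)‖_Σ dt/t < ∞`, and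
`φ = ∫₀^∞ f(t) dt/t` with convergence in `Σ(X̄)`. -/
structure IsJRep (φ : V) (f : ℝ → P.deltaSub) : Prop where
  meas : AEStronglyMeasurable f (volume.restrict (Set.Ioi (0:ℝ)))
  locInt : ∀ a b : ℝ, 0 < a → a < b →
    IntegrableOn (fun t => ‖f t‖ / t) (Set.Ioo a b)
  sigmaInt : ∫⁻ t in Set.Ioi (0:ℝ),
      P.normSigmaE (P.j0 ((f t : X0 × X1).1)) * ENNReal.ofReal t⁻¹ < ⊤
  conv : Tendsto (fun ab : ℝ × ℝ =>
      P.normSigmaE (φ - P.j0 (∫ t in Set.Ioo ab.1 ab.2, t⁻¹ • ((f t : X0 × X1).1))))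
      ((𝓝[>] (0:ℝ)) ×ˢ atTop) (𝓝 0)

/-- `inf_f ‖J(·,f(·))‖_{θ,q}` over all J-representations of `φ` (`∞` if none). -/
def JinfE (θ : ℝ) (q : ℝ≥0∞) (φ : V) : ℝ≥0∞ :=
  ⨅ (f : ℝ → P.deltaSub) (_ : P.IsJRep φ f),
    thetaNormE θ q (fun t => ENNReal.ofReal (Jfun t (f t : X0 × X1)))

/-- The underlying set of the interpolation space `J_{θ,q}(X̄)`. -/
def Jmem (θ : ℝ) (q : ℝ≥0∞) : Set V := {φ | P.JinfE θ q φ < ⊤}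

/-- The norm of `J_{θ,q}(X̄)` with the normalisation `N_{θ,q*}⁻¹ = ‖g‖_{θ,q*}`,
where `q*` is the conjugate exponent of `q`. -/
def JnormE (θ : ℝ) (q qstar : ℝ≥0∞) (φ : V) : ℝ≥0∞ :=
  thetaNormE θ qstar gfunE * P.JinfE θ q φ

/-- The norm of `J_{θ,2}(X̄)` with the explicit normalisation
`N_{θ,2}⁻¹ = ((2/π) sin (πθ))^{-1/2}`. -/
def Jnorm2E (θ : ℝ) (φ : V) : ℝ≥0∞ :=
  (ENNReal.ofReal (Real.sqrt (2 / Real.pi * Real.sin (Real.pi * θ))))⁻¹ * P.JinfE θ 2 φ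

end CompatiblePair

namespace CompatiblePair

variable {V X0 X1 : Type*} [AddCommGroup V] [Module ℂ V]
  [NormedAddCommGroup X0] [NormedSpace ℂ X0] [CompleteSpace X0]
  [NormedAddCommGroup X1] [NormedSpace ℂ X1] [CompleteSpace X1]
  (P : CompatiblePair V X0 X1)

/-- The space of the scale at parameter `s ∈ [0,1]`: `X0` if `s = 0`, `X1` if `s = 1`,
and `K_{s,2}(X̄)` if `0 < s < 1`. -/
def KsetX (s : ℝ) : Set V :=
  if s = 0 then Set.range P.j0 else if s = 1 then Set.range P.j1 else P.Kmem s 2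

/-- The norm of the scale at parameter `s ∈ [0,1]`: the `X0`-norm if `s = 0`, the
`X1`-norm if `s = 1`, and the `K_{s,2}`-norm (normalisation `((2/π) sin (πs))^{1/2}`)
if `0 < s < 1`. -/
def KnormX (s : ℝ) (x : V) : ℝ≥0∞ :=
  if s = 0 then P.norm0E x else if s = 1 then P.norm1E x else P.Knorm2E s x

end CompatiblePair

section InverseForm

variable {S : Type*} [NormedAddCommGroup S] [InnerProductSpace ℂ S]

/-- The quadratic form `⟪B⁻¹φ, φ⟫` of the inverse of a positive operator `B`, as a supremum;
it is `∞` off the form domain of `B⁻¹`. -/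
def invForm (B : S →L[ℂ] S) (φ : S) : ℝ≥0∞ :=
  ⨆ ψ : S, ENNReal.ofReal (2 * (inner ℂ φ ψ).re - (inner ℂ (B ψ) ψ).re)

lemma invForm_add_le (B C : S →L[ℂ] S) (φ ψ : S) :
    invForm (B + C) (φ + ψ) ≤ invForm B φ + invForm C ψ := by
  refine iSup_le fun χ => ?_
  refine le_trans ?_ (add_le_add
    (le_iSup (fun χ => ENNReal.ofReal (2 * (inner ℂ φ χ).re - (inner ℂ (B χ) χ).re)) χ)
    (le_iSup (fun χ => ENNReal.ofReal (2 * (inner ℂ ψ χ).re - (inner ℂ (C χ) χ).re)) χ))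
  refine le_trans (ENNReal.ofReal_le_ofReal (le_of_eq ?_)) ENNReal.ofReal_add_le
  simp only [add_apply, inner_add_left, Complex.add_re]
  ring

variable {X : Type*} [CompleteSpace S] [NormedAddCommGroup X] [InnerProductSpace ℂ X]
  [CompleteSpace X]

lemma re_inner_comp_adjoint (T : X →L[ℂ] S) (ψ : S) :
    (inner ℂ ((T ∘L T.adjoint) ψ) ψ).re = ‖T.adjoint ψ‖ ^ 2 := by
  rw [ContinuousLinearMap.comp_apply, ← ContinuousLinearMap.adjoint_inner_right]
  exact inner_self_eq_norm_sq (𝕜 := ℂ) _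

lemma invForm_apply_le (T : X →L[ℂ] S) (x : X) :
    invForm (T ∘L T.adjoint) (T x) ≤ ENNReal.ofReal (‖x‖ ^ 2) := by
  refine iSup_le fun ψ => ENNReal.ofReal_le_ofReal ?_
  rw [re_inner_comp_adjoint, ← ContinuousLinearMap.adjoint_inner_right]
  have h : (inner ℂ x (T.adjoint ψ)).re ≤ ‖x‖ * ‖T.adjoint ψ‖ :=
    (Complex.re_le_norm _).trans (norm_inner_le_norm _ _)
  nlinarith [sq_nonneg (‖x‖ - ‖T.adjoint ψ‖)]

lemma norm_inner_sq_le_of_invForm (T : X →L[ℂ] S) {φ : S}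
    (h : invForm (T ∘L T.adjoint) φ ≠ ⊤) (ψ : S) :
    ‖inner ℂ φ ψ‖ ^ 2 ≤ (invForm (T ∘L T.adjoint) φ).toReal * ‖T.adjoint ψ‖ ^ 2 := by
  set C := (invForm (T ∘L T.adjoint) φ).toReal
  have hC : 0 ≤ C := ENNReal.toReal_nonneg
  have key : ∀ ψ : S, 2 * (inner ℂ φ ψ).re - ‖T.adjoint ψ‖ ^ 2 ≤ C := fun ψ => by
    rw [← re_inner_comp_adjoint]
    exact (ENNReal.ofReal_le_iff_le_toReal h).1
      (le_iSup (fun ψ => ENNReal.ofReal (2 * (inner ℂ φ ψ).re -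
        (inner ℂ ((T ∘L T.adjoint) ψ) ψ).re)) ψ)
  set z := inner ℂ φ ψ with hz
  have key2 : ∀ s : ℝ, 2 * (s * ‖z‖ ^ 2) - s ^ 2 * ‖z‖ ^ 2 * ‖T.adjoint ψ‖ ^ 2 ≤ C := by
    intro s
    have := key (((s : ℂ) * (starRingEnd ℂ) z) • ψ)
    rw [inner_smul_right, ← hz, map_smul, norm_smul, mul_assoc, mul_comm _ z,
      Complex.mul_conj, ← Complex.ofReal_mul, Complex.ofReal_re, Complex.normSq_eq_norm_sq,
      norm_mul, Complex.norm_real, RCLike.norm_conj, mul_pow, mul_pow, Real.norm_eq_abs,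
      sq_abs] at this
    exact this
  rcases (norm_nonneg z).eq_or_lt with h0 | hpos
  · calc ‖z‖ ^ 2 = 0 := by rw [← h0]; simp
      _ ≤ _ := mul_nonneg hC (sq_nonneg _)
  have hp : 0 < ‖z‖ ^ 2 := by positivity
  rcases (norm_nonneg (T.adjoint ψ)).eq_or_lt with h1 | h1
  · have := key2 ((C + 1) / ‖z‖ ^ 2)
    rw [← h1, div_mul_cancel₀ _ hp.ne'] at this
    nlinarith
  · have hd : 0 < ‖T.adjoint ψ‖ ^ 2 := by positivity
    have := key2 (1 / ‖T.adjoint ψ‖ ^ 2)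
    have e : 2 * (1 / ‖T.adjoint ψ‖ ^ 2 * ‖z‖ ^ 2) - (1 / ‖T.adjoint ψ‖ ^ 2) ^ 2 * ‖z‖ ^ 2 *
        ‖T.adjoint ψ‖ ^ 2 = ‖z‖ ^ 2 / ‖T.adjoint ψ‖ ^ 2 := by
      field_simp; ring
    rw [e, div_le_iff₀ hd] at this
    exact this

/-- If `invForm (T T†) φ` is finite then `φ` has a preimage under `T` of minimal norm. -/
lemma exists_apply_eq_of_invForm (T : X →L[ℂ] S) {φ : S}
    (h : invForm (T ∘L T.adjoint) φ ≠ ⊤) :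
    ∃ x, T x = φ ∧ ENNReal.ofReal (‖x‖ ^ 2) ≤ invForm (T ∘L T.adjoint) φ := by
  set C := (invForm (T ∘L T.adjoint) φ).toReal with hCdef
  have hC : 0 ≤ C := ENNReal.toReal_nonneg
  have key := norm_inner_sq_le_of_invForm T h
  rw [← hCdef] at key
  have key' : ∀ ψ, ‖inner ℂ φ ψ‖ ≤ √C * ‖T.adjoint ψ‖ := fun ψ => by
    refine abs_le_of_sq_le_sq' ?_ (by positivity) |>.2
    rw [mul_pow, Real.sq_sqrt hC]; exact key ψ
  let A : S →ₗ[ℂ] X := T.adjoint.toLinearMap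
  obtain ⟨g, hg⟩ := A.rangeRestrict.exists_rightInverse_of_surjective A.range_rangeRestrict
  have hg' : ∀ r, T.adjoint (g r) = r := fun r =>
    congrArg Subtype.val (LinearMap.congr_fun hg r)
  let ℓ : A.range →ₗ[ℂ] ℂ := (innerSL ℂ φ).toLinearMap ∘ₗ g
  have hℓ : ∀ r, ‖ℓ r‖ ≤ √C * ‖r‖ := fun r => by
    have := key' (g r)
    rw [hg'] at this
    exact this
  obtain ⟨f, hf, hfn⟩ := exists_extension_norm_eq _ (ℓ.mkContinuous _ hℓ)
  have hx : ‖(InnerProductSpace.toDual ℂ X).symm f‖ ≤ √C := by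
    rw [LinearIsometryEquiv.norm_map, hfn]
    exact ℓ.mkContinuous_norm_le (Real.sqrt_nonneg _) _
  refine ⟨(InnerProductSpace.toDual ℂ X).symm f, ?_, ?_⟩
  · refine ext_inner_right ℂ fun ψ => ?_
    rw [← ContinuousLinearMap.adjoint_inner_right, InnerProductSpace.toDual_symm_apply]
    have e1 : f (T.adjoint ψ) = inner ℂ φ (g (A.rangeRestrict ψ)) := hf (A.rangeRestrict ψ)
    have e2 : inner ℂ φ (g (A.rangeRestrict ψ) - ψ) = 0 := by
      have := key' (g (A.rangeRestrict ψ) - ψ)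
      have e3 : T.adjoint (g (A.rangeRestrict ψ) - ψ) = 0 := by
        rw [map_sub, hg']; exact sub_self _
      rw [e3, norm_zero, mul_zero] at this
      exact norm_le_zero_iff.1 this
    rw [inner_sub_right, sub_eq_zero] at e2
    rw [e1, e2]
  · rw [← ENNReal.ofReal_toReal h, ← hCdef]
    refine ENNReal.ofReal_le_ofReal ?_
    calc _ ≤ √C ^ 2 := by gcongr
      _ = C := Real.sq_sqrt hC

/-- The minimal splitting of `φ` with respect to a pair of operator ranges. -/
lemma exists_add_eq_of_invForm {Y : Type*} [NormedAddCommGroup Y] [InnerProductSpace ℂ Y]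
    [CompleteSpace Y] (T : X →L[ℂ] S) (U : Y →L[ℂ] S) {φ : S}
    (h : invForm (T ∘L T.adjoint + U ∘L U.adjoint) φ ≠ ⊤) :
    ∃ φ₀ φ₁, φ₀ + φ₁ = φ ∧ invForm (T ∘L T.adjoint) φ₀ + invForm (U ∘L U.adjoint) φ₁ ≤
      invForm (T ∘L T.adjoint + U ∘L U.adjoint) φ := by
  let R : WithLp 2 (X × Y) →L[ℂ] S := T ∘L WithLp.fstL 2 ℂ X Y + U ∘L WithLp.sndL 2 ℂ X Y
  have hR : R.adjoint = (WithLp.prodContinuousLinearEquiv 2 ℂ X Y).symm.toContinuousLinearMap ∘L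
      (T.adjoint.prod U.adjoint) := by
    symm
    rw [ContinuousLinearMap.eq_adjoint_iff]
    intro s w
    simp [R, WithLp.prod_inner_apply, inner_add_right, ContinuousLinearMap.adjoint_inner_left]
  have hRR : R ∘L R.adjoint = T ∘L T.adjoint + U ∘L U.adjoint := by
    rw [hR]
    ext s
    simp [R]
  rw [← hRR] at h ⊢
  obtain ⟨w, hw, hle⟩ := exists_apply_eq_of_invForm R h
  refine ⟨T w.fst, U w.snd, by simpa [R] using hw, ?_⟩
  refine (add_le_add (invForm_apply_le T _) (invForm_apply_le U _)).trans (le_trans ?_ hle)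
  rw [← ENNReal.ofReal_add (by positivity) (by positivity), WithLp.prod_norm_sq_eq_of_L2]

end InverseForm

section SpectralMeasure

variable {S : Type*} [NormedAddCommGroup S] [InnerProductSpace ℂ S] [CompleteSpace S]
  {X : Type*} [TopologicalSpace X] (Φ : C(X, ℝ) →⋆ₐ[ℝ] (S →L[ℂ] S))

lemma adjoint_starAlgHom (f : C(X, ℝ)) : (Φ f).adjoint = Φ f := by
  rw [← ContinuousLinearMap.star_eq_adjoint, ← map_star, star_trivial]

lemma inner_starAlgHom (f : C(X, ℝ)) (φ ψ : S) : inner ℂ (Φ f φ) ψ = inner ℂ φ (Φ f ψ) := by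
  rw [← ContinuousLinearMap.adjoint_inner_right, adjoint_starAlgHom]

lemma starAlgHom_eq_comp_adjoint {f : C(X, ℝ)} (hf : 0 ≤ f) :
    ∃ T : S →L[ℂ] S, T ∘L T.adjoint = Φ f := by
  let r : C(X, ℝ) := ⟨fun x => √(f x), by fun_prop⟩
  have hr : r * r = f := by
    ext x
    exact Real.mul_self_sqrt (hf x)
  refine ⟨Φ r, ?_⟩
  rw [adjoint_starAlgHom, ← ContinuousLinearMap.mul_def, ← map_mul, hr]

lemma re_inner_starAlgHom_nonneg {f : C(X, ℝ)} (hf : 0 ≤ f) (φ : S) :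
    0 ≤ (inner ℂ (Φ f φ) φ).re := by
  obtain ⟨T, hT⟩ := starAlgHom_eq_comp_adjoint Φ hf
  rw [← hT, re_inner_comp_adjoint]
  positivity

lemma exists_spectralMeasure [CompactSpace X] [T2Space X] [MeasurableSpace X] [BorelSpace X]
    (φ : S) : ∃ μ : Measure X, IsFiniteMeasure μ ∧
      ∀ f : C(X, ℝ), (inner ℂ (Φ f φ) φ).re = ∫ x, f x ∂μ := by
  let Λ₀ : CompactlySupportedContinuousMap X ℝ →ₗ[ℝ] ℝ :=
    { toFun := fun f => (inner ℂ (Φ f.toContinuousMap φ) φ).re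
      map_add' := fun f g => by
        have : (f + g).toContinuousMap = f.toContinuousMap + g.toContinuousMap := rfl
        rw [this, map_add, add_apply, inner_add_left, Complex.add_re]
      map_smul' := fun c f => by
        have : (c • f).toContinuousMap = c • f.toContinuousMap := rfl
        rw [this, map_smul, smul_apply, ← Complex.coe_smul,
          inner_smul_left, Complex.conj_ofReal, Complex.re_ofReal_mul]
        rfl }
  let Λ : CompactlySupportedContinuousMap X ℝ →ₚ[ℝ] ℝ :=
    PositiveLinearMap.mk₀ Λ₀ fun f hf => re_inner_starAlgHom_nonneg Φ (fun x => hf x) φ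
  refine ⟨RealRMK.rieszMeasure Λ, inferInstance, fun f => ?_⟩
  let f' : CompactlySupportedContinuousMap X ℝ := ⟨f, HasCompactSupport.of_compactSpace _⟩
  exact (RealRMK.integral_rieszMeasure Λ f').symm

lemma invForm_starAlgHom_eq_lintegral [CompactSpace X] [MeasurableSpace X] [BorelSpace X]
    {φ : S} {μ : Measure X} [IsFiniteMeasure μ]
    (hμ : ∀ f : C(X, ℝ), (inner ℂ (Φ f φ) φ).re = ∫ x, f x ∂μ) {f : C(X, ℝ)} (hf : 0 ≤ f) :
    invForm (Φ f) φ = ∫⁻ x, (ENNReal.ofReal (f x))⁻¹ ∂μ := by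
  have hne : ∀ ε : ℝ, 0 < ε → ∀ x, 0 < f x + ε := fun ε hε x => add_pos_of_nonneg_of_pos (hf x) hε
  let h : ∀ ε : ℝ, 0 < ε → C(X, ℝ) := fun ε hε =>
    ⟨fun x => (f x + ε)⁻¹, Continuous.inv₀ (by fun_prop) fun x => (hne ε hε x).ne'⟩
  have hfh : ∀ ε hε, (f + algebraMap ℝ _ ε) * h ε hε = 1 := fun ε hε => by
    ext x
    exact mul_inv_cancel₀ (hne ε hε x).ne'
  have hhpos : ∀ ε hε, 0 ≤ h ε hε := fun ε hε x => (inv_pos.2 (hne ε hε x)).le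
  have hint : ∀ ε hε, ENNReal.ofReal (inner ℂ (Φ (h ε hε) φ) φ).re =
      ∫⁻ x, (ENNReal.ofReal (f x + ε))⁻¹ ∂μ := fun ε hε => by
    rw [hμ, ofReal_integral_eq_lintegral_ofReal]
    · refine lintegral_congr fun x => ?_
      exact ENNReal.ofReal_inv_of_pos (hne ε hε x)
    · exact (h ε hε).continuous.integrable_of_hasCompactSupport
        (HasCompactSupport.of_compactSpace _)
    · exact Eventually.of_forall (hhpos ε hε)
  have hΦε : ∀ ε : ℝ, ∀ ψ, Φ (f + algebraMap ℝ _ ε) ψ = Φ f ψ + (ε : ℂ) • ψ := fun ε ψ => by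
    rw [map_add, AlgHomClass.commutes, add_apply, Algebra.algebraMap_eq_smul_one]
    simp
  apply le_antisymm
  · refine iSup_le fun ψ => ?_
    have key : ∀ ε : ℝ, 0 < ε → ENNReal.ofReal (2 * (inner ℂ φ ψ).re - (inner ℂ (Φ f ψ) ψ).re)
        ≤ ∫⁻ x, (ENNReal.ofReal (f x))⁻¹ ∂μ + ENNReal.ofReal (ε * ‖ψ‖ ^ 2) := by
      intro ε hε
      have h1 := re_inner_starAlgHom_nonneg Φ (f := f + algebraMap ℝ _ ε)
        (fun x => (hne ε hε x).le) (ψ - Φ (h ε hε) φ)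
      have h2 : Φ (f + algebraMap ℝ _ ε) (Φ (h ε hε) φ) = φ := by
        rw [← mul_apply_eq_comp, ← map_mul, hfh _ hε, map_one]; rfl
      have h3 : inner ℂ (Φ (f + algebraMap ℝ _ ε) ψ) (Φ (h ε hε) φ) = inner ℂ ψ φ := by
        rw [inner_starAlgHom, h2]
      have h4 : (inner ℂ (Φ (f + algebraMap ℝ _ ε) ψ) ψ).re =
          (inner ℂ (Φ f ψ) ψ).re + ε * ‖ψ‖ ^ 2 := by
        rw [hΦε, inner_add_left, inner_smul_left, Complex.conj_ofReal, Complex.add_re,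
          Complex.re_ofReal_mul]
        congr 2
        exact inner_self_eq_norm_sq (𝕜 := ℂ) ψ
      have h5 : (inner ℂ ψ φ).re = (inner ℂ φ ψ).re := inner_re_symm (𝕜 := ℂ) _ _
      have h6 : (inner ℂ φ (Φ (h ε hε) φ)).re = (inner ℂ (Φ (h ε hε) φ) φ).re :=
        inner_re_symm (𝕜 := ℂ) _ _
      rw [map_sub, h2, inner_sub_left, inner_sub_right, inner_sub_right, h3, Complex.sub_re,
        Complex.sub_re, Complex.sub_re, h4, h5, h6] at h1
      calc _ ≤ ENNReal.ofReal ((inner ℂ (Φ (h ε hε) φ) φ).re + ε * ‖ψ‖ ^ 2) :=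
            ENNReal.ofReal_le_ofReal (by linarith)
        _ ≤ ENNReal.ofReal (inner ℂ (Φ (h ε hε) φ) φ).re + ENNReal.ofReal (ε * ‖ψ‖ ^ 2) :=
            ENNReal.ofReal_add_le
        _ ≤ _ := by
            rw [hint _ hε]
            gcongr with x
            linarith
    have hlim : Tendsto (fun ε : ℝ => ∫⁻ x, (ENNReal.ofReal (f x))⁻¹ ∂μ +
        ENNReal.ofReal (ε * ‖ψ‖ ^ 2)) (𝓝[>] 0) (𝓝 (∫⁻ x, (ENNReal.ofReal (f x))⁻¹ ∂μ + 0)) := by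
      refine tendsto_const_nhds.add (tendsto_nhdsWithin_of_tendsto_nhds ?_)
      have : Continuous fun ε : ℝ => ENNReal.ofReal (ε * ‖ψ‖ ^ 2) :=
        ENNReal.continuous_ofReal.comp (by fun_prop)
      simpa using this.tendsto 0
    rw [add_zero] at hlim
    exact ge_of_tendsto hlim (eventually_mem_nhdsWithin.mono fun ε hε => key ε hε)
  · have hmono : ∫⁻ x, (ENNReal.ofReal (f x))⁻¹ ∂μ =
        ⨆ n : ℕ, ∫⁻ x, (ENNReal.ofReal (f x + 1 / (n + 1)))⁻¹ ∂μ := by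
      rw [← lintegral_iSup]
      · refine lintegral_congr fun x => ?_
        rw [← ENNReal.inv_iInf]
        congr 1
        have hanti : Antitone fun n : ℕ => ENNReal.ofReal (f x + 1 / ((n : ℝ) + 1)) :=
          fun m n hmn => by
            dsimp only
            gcongr
        refine tendsto_nhds_unique ?_ (tendsto_atTop_iInf hanti)
        have := (ENNReal.continuous_ofReal.tendsto _).comp
          ((tendsto_const_nhds (x := f x)).add (tendsto_one_div_add_atTop_nhds_zero_nat (𝕜 := ℝ)))
        simpa [Function.comp_def] using this
      · intro n
        have : Continuous fun x => ENNReal.ofReal (f x + 1 / ((n : ℝ) + 1)) :=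
          ENNReal.continuous_ofReal.comp (by fun_prop)
        exact this.measurable.inv
      · intro m n hmn x
        dsimp only
        gcongr
    rw [hmono]
    refine iSup_le fun n => ?_
    have hε : (0 : ℝ) < 1 / (n + 1) := by positivity
    rw [← hint _ hε]
    refine le_trans (ENNReal.ofReal_le_ofReal ?_)
      (le_iSup (fun ψ => ENNReal.ofReal (2 * (inner ℂ φ ψ).re - (inner ℂ (Φ f ψ) ψ).re))
        (Φ (h _ hε) φ))
    set ε : ℝ := 1 / (n + 1)
    have h2 : Φ f (Φ (h ε hε) φ) = φ - (ε : ℂ) • Φ (h ε hε) φ := by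
      rw [eq_sub_iff_add_eq, ← hΦε, ← mul_apply_eq_comp, ← map_mul, hfh _ hε, map_one]; rfl
    have h6 : (inner ℂ φ (Φ (h ε hε) φ)).re = (inner ℂ (Φ (h ε hε) φ) φ).re :=
      inner_re_symm (𝕜 := ℂ) _ _
    rw [h2, inner_sub_left, inner_smul_left, Complex.conj_ofReal, Complex.sub_re,
      Complex.re_ofReal_mul, h6]
    have h7 : 0 ≤ (inner ℂ (Φ (h ε hε) φ) (Φ (h ε hε) φ)).re := inner_self_nonneg (𝕜 := ℂ)
    nlinarith [mul_nonneg hε.le h7]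

lemma exists_add_eq_of_invForm_starAlgHom {f g : C(X, ℝ)} (hf : 0 ≤ f) (hg : 0 ≤ g) {φ : S}
    (h : invForm (Φ (f + g)) φ ≠ ⊤) :
    ∃ φ₀ φ₁, φ₀ + φ₁ = φ ∧ invForm (Φ f) φ₀ + invForm (Φ g) φ₁ ≤ invForm (Φ (f + g)) φ := by
  obtain ⟨T, hT⟩ := starAlgHom_eq_comp_adjoint Φ hf
  obtain ⟨U, hU⟩ := starAlgHom_eq_comp_adjoint Φ hg
  rw [map_add, ← hT, ← hU] at h ⊢
  exact exists_add_eq_of_invForm T U h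

end SpectralMeasure

section BetaIntegral

lemma lintegral_rpow_mul_one_sub_rpow {η : ℝ} (h0 : 0 < η) (h1 : η < 1) :
    ∫⁻ x in Ioo (0 : ℝ) 1, ENNReal.ofReal (x ^ (-η) * (1 - x) ^ (η - 1)) =
      ENNReal.ofReal (Real.pi / Real.sin (Real.pi * η)) := by
  have h1' : 0 < 1 - η := by linarith
  have hb : ProbabilityTheory.beta (1 - η) η = Real.pi / Real.sin (Real.pi * η) := by
    rw [ProbabilityTheory.beta, mul_comm, Real.Gamma_mul_Gamma_one_sub]
    simp
  have hpos := ProbabilityTheory.beta_pos h1' h0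
  have h := ProbabilityTheory.lintegral_betaPDF_eq_one h1' h0
  rw [ProbabilityTheory.lintegral_betaPDF] at h
  rw [← hb]
  calc _ = ∫⁻ x in Ioo (0 : ℝ) 1, ENNReal.ofReal (ProbabilityTheory.beta (1 - η) η) *
        ENNReal.ofReal (1 / ProbabilityTheory.beta (1 - η) η * x ^ (1 - η - 1) *
          (1 - x) ^ (η - 1)) := by
        refine lintegral_congr fun x => ?_
        rw [← ENNReal.ofReal_mul hpos.le, mul_assoc, ← mul_assoc,
          mul_one_div_cancel hpos.ne', one_mul]
        congr 3
        ring
    _ = _ := by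
        rw [lintegral_const_mul' _ _ ENNReal.ofReal_ne_top, h, mul_one]

lemma image_sq_mul_div_add {b c : ℝ} (hb : 0 < b) (hc : 0 < c) :
    (fun s : ℝ => s ^ 2 * b / (s ^ 2 * b + c)) '' Ioi 0 = Ioo 0 1 := by
  ext x
  constructor
  · rintro ⟨s, hs, rfl⟩
    have hs : 0 < s := hs
    refine ⟨by positivity, ?_⟩
    rw [div_lt_one (by positivity)]
    linarith
  · rintro ⟨h0, h1⟩
    have h2 : 0 < 1 - x := by linarith
    have h3 : 0 < x * c / ((1 - x) * b) := by positivity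
    refine ⟨√(x * c / ((1 - x) * b)), Real.sqrt_pos.2 h3, ?_⟩
    dsimp only
    rw [Real.sq_sqrt h3.le]
    field_simp
    ring

lemma injOn_sq_mul_div_add {b c : ℝ} (hb : 0 < b) (hc : 0 < c) :
    InjOn (fun s : ℝ => s ^ 2 * b / (s ^ 2 * b + c)) (Ioi 0) := by
  intro s hs t ht h
  have hs : 0 < s := hs
  have ht : 0 < t := ht
  dsimp only at h
  rw [div_eq_div_iff (by positivity) (by positivity)] at h
  have h2 : s ^ 2 * (b * c) = t ^ 2 * (b * c) := by linarith
  have h3 := mul_right_cancel₀ (by positivity) h2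
  exact (pow_left_inj₀ hs.le ht.le two_ne_zero).1 h3

lemma lintegral_rpow_div_of_pos {η : ℝ} (h0 : 0 < η) (h1 : η < 1) {b c : ℝ} (hb : 0 < b)
    (hc : 0 < c) :
    ENNReal.ofReal (2 / Real.pi * Real.sin (Real.pi * η)) * ∫⁻ s in Ioi (0 : ℝ),
      ENNReal.ofReal (s ^ (-2 * η - 1)) * (ENNReal.ofReal (b + (s ^ 2)⁻¹ * c))⁻¹ =
      (ENNReal.ofReal (b ^ (1 - η) * c ^ η))⁻¹ := by
  have hsin : 0 < Real.sin (Real.pi * η) :=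
    Real.sin_pos_of_pos_of_lt_pi (by positivity) (by nlinarith [Real.pi_pos])
  have hderiv : ∀ s ∈ Ioi (0 : ℝ), HasDerivWithinAt (fun s : ℝ => s ^ 2 * b / (s ^ 2 * b + c))
      (2 * s * b * c / (s ^ 2 * b + c) ^ 2) (Ioi 0) s := by
    intro s hs
    have hs : 0 < s := hs
    have e : HasDerivAt (fun s : ℝ => s ^ 2 * b) (2 * s * b) s := by
      simpa using (hasDerivAt_pow 2 s).mul_const b
    exact ((e.div (e.add_const c) (by positivity)).congr_deriv (by ring)).hasDerivWithinAt
  have hcov := lintegral_image_eq_lintegral_abs_deriv_mul measurableSet_Ioi hderiv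
    (injOn_sq_mul_div_add hb hc) fun x => ENNReal.ofReal (x ^ (-η) * (1 - x) ^ (η - 1))
  rw [image_sq_mul_div_add hb hc, lintegral_rpow_mul_one_sub_rpow h0 h1] at hcov
  have hpt : ∀ s ∈ Ioi (0 : ℝ), ENNReal.ofReal |2 * s * b * c / (s ^ 2 * b + c) ^ 2| *
      ENNReal.ofReal ((s ^ 2 * b / (s ^ 2 * b + c)) ^ (-η) *
        (1 - s ^ 2 * b / (s ^ 2 * b + c)) ^ (η - 1)) =
      ENNReal.ofReal (2 * (b ^ (1 - η) * c ^ η)) * (ENNReal.ofReal (s ^ (-2 * η - 1)) *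
        (ENNReal.ofReal (b + (s ^ 2)⁻¹ * c))⁻¹) := by
    intro s hs
    have hs : 0 < s := hs
    have hD : 0 < s ^ 2 * b + c := by positivity
    rw [← ENNReal.ofReal_inv_of_pos (by positivity), ← ENNReal.ofReal_mul (by positivity),
      ← ENNReal.ofReal_mul (by positivity), ← ENNReal.ofReal_mul (by positivity)]
    congr 1
    have e1 : 1 - s ^ 2 * b / (s ^ 2 * b + c) = c / (s ^ 2 * b + c) := by field_simp; ring
    rw [abs_of_pos (by positivity), e1, Real.div_rpow (by positivity) hD.le,
      Real.div_rpow hc.le hD.le, Real.mul_rpow (by positivity) hb.le]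
    rw [← Real.rpow_natCast s 2, ← Real.rpow_mul hs.le]
    have e2 : (s ^ ((2 : ℕ) : ℝ) * b + c) ^ (η - 1) =
        (s ^ ((2 : ℕ) : ℝ) * b + c) ^ η / (s ^ ((2 : ℕ) : ℝ) * b + c) := by
      rw [Real.rpow_sub_one]; positivity
    rw [e2, Real.rpow_neg hb.le, Real.rpow_sub hb, Real.rpow_one, Real.rpow_sub_one hc.ne',
      Real.rpow_sub_one hs.ne', Real.rpow_neg (by positivity)]
    have e3 : ((2 : ℕ) : ℝ) * -η = -2 * η := by push_cast; ring
    rw [e3]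
    simp only [Real.rpow_natCast]
    have := Real.rpow_pos_of_pos hb η
    have := Real.rpow_pos_of_pos hc η
    have := Real.rpow_pos_of_pos hD η
    field_simp
  rw [setLIntegral_congr_fun measurableSet_Ioi hpt,
    lintegral_const_mul' _ _ ENNReal.ofReal_ne_top] at hcov
  set I := ∫⁻ s in Ioi (0 : ℝ),
      ENNReal.ofReal (s ^ (-2 * η - 1)) * (ENNReal.ofReal (b + (s ^ 2)⁻¹ * c))⁻¹
  have hd : 0 < b ^ (1 - η) * c ^ η := by positivity
  set d := b ^ (1 - η) * c ^ η
  have h2 : ENNReal.ofReal d * (ENNReal.ofReal (2 / Real.pi * Real.sin (Real.pi * η)) * I) = 1 := by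
    have e : ENNReal.ofReal (2 / Real.pi * Real.sin (Real.pi * η)) * ENNReal.ofReal d =
        ENNReal.ofReal (Real.sin (Real.pi * η) / Real.pi) * ENNReal.ofReal (2 * d) := by
      rw [← ENNReal.ofReal_mul (by positivity), ← ENNReal.ofReal_mul (by positivity)]
      congr 1
      ring
    rw [← mul_assoc, mul_comm (ENNReal.ofReal d), e, mul_assoc, ← hcov,
      ← ENNReal.ofReal_mul (by positivity), div_mul_div_comm, mul_comm, div_self (by positivity),
      ENNReal.ofReal_one]
  exact ENNReal.eq_inv_of_mul_eq_one_left (by rw [mul_comm]; exact h2)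

lemma lintegral_rpow_div {η : ℝ} (h0 : 0 < η) (h1 : η < 1) {b c : ℝ} (hb : 0 ≤ b)
    (hc : 0 ≤ c) :
    ENNReal.ofReal (2 / Real.pi * Real.sin (Real.pi * η)) * ∫⁻ s in Ioi (0 : ℝ),
      ENNReal.ofReal (s ^ (-2 * η - 1)) * (ENNReal.ofReal (b + (s ^ 2)⁻¹ * c))⁻¹ =
      (ENNReal.ofReal (b ^ (1 - η) * c ^ η))⁻¹ := by
  have h1' : 0 < 1 - η := by linarith
  by_cases h : 0 < b ∧ 0 < c
  · exact lintegral_rpow_div_of_pos h0 h1 h.1 h.2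
  have hz : b ^ (1 - η) * c ^ η = 0 := by
    rcases hb.eq_or_lt with rfl | hb'
    · rw [Real.zero_rpow h1'.ne', zero_mul]
    · have : c = 0 := le_antisymm (not_lt.1 fun hc' => h ⟨hb', hc'⟩) hc
      rw [this, Real.zero_rpow h0.ne', mul_zero]
  have hlim : Tendsto (fun ε : ℝ => (ENNReal.ofReal ((b + ε) ^ (1 - η) * (c + ε) ^ η))⁻¹) (𝓝[>] 0)
      (𝓝 (ENNReal.ofReal (b ^ (1 - η) * c ^ η))⁻¹) := by
    refine tendsto_nhdsWithin_of_tendsto_nhds ?_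
    have hcont : Continuous fun ε : ℝ => (b + ε) ^ (1 - η) * (c + ε) ^ η :=
      ((continuous_const.add continuous_id).rpow_const fun _ => Or.inr h1'.le).mul
        ((continuous_const.add continuous_id).rpow_const fun _ => Or.inr h0.le)
    have hcont' : Continuous fun ε : ℝ => (ENNReal.ofReal ((b + ε) ^ (1 - η) * (c + ε) ^ η))⁻¹ :=
      (ENNReal.continuous_ofReal.comp hcont).inv
    have := hcont'.tendsto 0
    simp only [add_zero] at this
    exact this
  rw [hz, ENNReal.ofReal_zero, ENNReal.inv_zero] at hlim ⊢
  rw [← top_le_iff]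
  refine le_of_tendsto hlim (eventually_mem_nhdsWithin.mono fun ε hε => ?_)
  have hε : 0 < ε := hε
  rw [← lintegral_rpow_div_of_pos h0 h1 (b := b + ε) (c := c + ε) (by linarith) (by linarith)]
  gcongr <;> linarith

end BetaIntegral

lemma thetaNormE_two_sq (θ : ℝ) (F : ℝ → ℝ≥0∞) :
    thetaNormE θ 2 F ^ 2 = ∫⁻ t in Ioi (0 : ℝ), ENNReal.ofReal (t ^ (-2 * θ - 1)) * F t ^ 2 := by
  rw [thetaNormE, if_neg ENNReal.ofNat_ne_top, ← ENNReal.rpow_natCast, ← ENNReal.rpow_mul]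
  have e : 1 / (2 : ℝ≥0∞).toReal * ((2 : ℕ) : ℝ) = 1 := by simp
  rw [e, ENNReal.rpow_one, logMeasure, lintegral_withDensity_eq_lintegral_mul_non_measurable _
    (by fun_prop) (Eventually.of_forall fun _ => ENNReal.ofReal_lt_top)]
  refine setLIntegral_congr_fun measurableSet_Ioi fun t ht => ?_
  have ht : 0 < t := ht
  have e2 : (2 : ℝ≥0∞).toReal = ((2 : ℕ) : ℝ) := by simp
  simp only [Pi.mul_apply, e2, ENNReal.rpow_natCast]
  rw [mul_pow, ← mul_assoc, ← ENNReal.ofReal_pow (by positivity),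
    ← ENNReal.ofReal_mul (by positivity)]
  congr 2
  rw [← Real.rpow_natCast, ← Real.rpow_mul ht.le, ← Real.rpow_neg_one, ← Real.rpow_add ht]
  congr 1
  push_cast
  ring

lemma lintegral_Ioi_inv (F : ℝ → ℝ≥0∞) :
    ∫⁻ t in Ioi (0 : ℝ), F t = ∫⁻ t in Ioi (0 : ℝ), ENNReal.ofReal (t ^ 2)⁻¹ * F t⁻¹ := by
  have himg : (fun t : ℝ => t⁻¹) '' Ioi 0 = Ioi 0 := by
    ext t
    exact ⟨fun ⟨s, hs, h⟩ => h ▸ inv_pos.2 (mem_Ioi.1 hs),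
      fun h => ⟨t⁻¹, inv_pos.2 (mem_Ioi.1 h), inv_inv t⟩⟩
  have := lintegral_image_eq_lintegral_abs_deriv_mul measurableSet_Ioi
    (fun t (ht : t ∈ Ioi (0 : ℝ)) => (hasDerivAt_inv (ne_of_gt ht)).hasDerivWithinAt)
    inv_injective.injOn F
  rw [himg] at this
  simpa [abs_neg] using this

namespace CompatiblePair

variable {V X0 X1 : Type*} [AddCommGroup V] [Module ℂ V]
  [NormedAddCommGroup X0] [NormedSpace ℂ X0] [CompleteSpace X0]
  [NormedAddCommGroup X1] [NormedSpace ℂ X1] [CompleteSpace X1]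
  (P : CompatiblePair V X0 X1)

lemma norm0E_j0 (a : X0) : P.norm0E (P.j0 a) = ENNReal.ofReal ‖a‖ := by
  refine le_antisymm (sInf_le ⟨a, rfl, rfl⟩) (le_sInf ?_)
  rintro r ⟨b, hb, rfl⟩
  rw [P.inj0 hb]

lemma norm1E_j1 (a : X1) : P.norm1E (P.j1 a) = ENNReal.ofReal ‖a‖ := by
  refine le_antisymm (sInf_le ⟨a, rfl, rfl⟩) (le_sInf ?_)
  rintro r ⟨b, hb, rfl⟩
  rw [P.inj1 hb]

lemma norm0E_eq_top {φ : V} (h : φ ∉ range P.j0) : P.norm0E φ = ⊤ := by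
  refine sInf_eq_top.2 ?_
  rintro r ⟨a, ha, -⟩
  exact (h ⟨a, ha⟩).elim

lemma norm1E_eq_top {φ : V} (h : φ ∉ range P.j1) : P.norm1E φ = ⊤ := by
  refine sInf_eq_top.2 ?_
  rintro r ⟨a, ha, -⟩
  exact (h ⟨a, ha⟩).elim

lemma norm0E_lt_top_iff {φ : V} : P.norm0E φ < ⊤ ↔ φ ∈ range P.j0 := by
  refine ⟨fun h => by_contra fun h' => h.ne (P.norm0E_eq_top h'), ?_⟩
  rintro ⟨a, rfl⟩
  rw [norm0E_j0]
  exact ENNReal.ofReal_lt_top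

lemma norm1E_lt_top_iff {φ : V} : P.norm1E φ < ⊤ ↔ φ ∈ range P.j1 := by
  refine ⟨fun h => by_contra fun h' => h.ne (P.norm1E_eq_top h'), ?_⟩
  rintro ⟨a, rfl⟩
  rw [norm1E_j1]
  exact ENNReal.ofReal_lt_top

lemma ofReal_sqrt_sq_add (t : ℝ) (a : X0) (b : X1) :
    ENNReal.ofReal √(‖a‖ ^ 2 + t ^ 2 * ‖b‖ ^ 2) ^ 2 =
      P.norm0E (P.j0 a) ^ 2 + ENNReal.ofReal (t ^ 2) * P.norm1E (P.j1 b) ^ 2 := by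
  rw [norm0E_j0, norm1E_j1, ← ENNReal.ofReal_pow (by positivity), Real.sq_sqrt (by positivity),
    ENNReal.ofReal_add (by positivity) (by positivity), ENNReal.ofReal_mul (by positivity),
    ENNReal.ofReal_pow (norm_nonneg a), ENNReal.ofReal_pow (norm_nonneg b)]

lemma KfunE_sq_le (t : ℝ) (a : X0) (b : X1) :
    P.KfunE t (P.j0 a + P.j1 b) ^ 2 ≤
      P.norm0E (P.j0 a) ^ 2 + ENNReal.ofReal (t ^ 2) * P.norm1E (P.j1 b) ^ 2 := by
  rw [← ofReal_sqrt_sq_add]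
  gcongr
  exact sInf_le ⟨a, b, rfl, rfl⟩

lemma le_KfunE_sq {t : ℝ} {φ : V} {C : ℝ≥0∞} (h : ∀ a b, P.j0 a + P.j1 b = φ →
      C ≤ P.norm0E (P.j0 a) ^ 2 + ENNReal.ofReal (t ^ 2) * P.norm1E (P.j1 b) ^ 2) :
    C ≤ P.KfunE t φ ^ 2 := by
  have key : C ^ (2⁻¹ : ℝ) ≤ P.KfunE t φ := by
    refine le_sInf ?_
    rintro r ⟨a, b, hab, rfl⟩
    have h1 := h a b hab
    rw [← ofReal_sqrt_sq_add] at h1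
    have h2 := ENNReal.rpow_le_rpow h1 (z := 2⁻¹) (by norm_num)
    rwa [← ENNReal.rpow_natCast, ← ENNReal.rpow_mul,
      show ((2 : ℕ) : ℝ) * 2⁻¹ = 1 by norm_num, ENNReal.rpow_one] at h2
  have h2 := pow_le_pow_left' key 2
  rwa [← ENNReal.rpow_natCast, ← ENNReal.rpow_mul,
    show (2⁻¹ : ℝ) * ((2 : ℕ) : ℝ) = 1 by norm_num, ENNReal.rpow_one] at h2

lemma KfunE_eq_top {t : ℝ} {φ : V} (h : φ ∉ P.sigmaSet) : P.KfunE t φ = ⊤ := by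
  refine sInf_eq_top.2 ?_
  rintro r ⟨a, b, hab, -⟩
  exact (h ⟨a, b, hab⟩).elim

lemma Knorm2E_sq (θ : ℝ) (φ : V) :
    P.Knorm2E θ φ ^ 2 = ENNReal.ofReal (2 / Real.pi * Real.sin (Real.pi * θ)) *
      ∫⁻ t in Ioi (0 : ℝ), ENNReal.ofReal (t ^ (-2 * θ - 1)) * P.KfunE t φ ^ 2 := by
  rw [Knorm2E, mul_pow, KquasinormE, thetaNormE_two_sq]
  congr 1
  rcases le_total 0 (2 / Real.pi * Real.sin (Real.pi * θ)) with h | h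
  · rw [← ENNReal.ofReal_pow (by positivity), Real.sq_sqrt h]
  · rw [Real.sqrt_eq_zero'.2 h, ENNReal.ofReal_of_nonpos h]
    simp

lemma sin_const_pos {θ : ℝ} (h0 : 0 < θ) (h1 : θ < 1) :
    0 < 2 / Real.pi * Real.sin (Real.pi * θ) :=
  mul_pos (by positivity)
    (Real.sin_pos_of_pos_of_lt_pi (by positivity) (by nlinarith [Real.pi_pos]))

lemma Knorm2E_eq_top {θ : ℝ} (h0 : 0 < θ) (h1 : θ < 1) {φ : V} (h : φ ∉ P.sigmaSet) :
    P.Knorm2E θ φ = ⊤ := by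
  have hc := sin_const_pos h0 h1
  have : P.Knorm2E θ φ ^ 2 = ⊤ := by
    rw [Knorm2E_sq]
    refine ENNReal.mul_eq_top.2 (Or.inl ⟨by simpa using hc, ?_⟩)
    have : ∀ t ∈ Ioi (0 : ℝ), ENNReal.ofReal (t ^ (-2 * θ - 1)) * P.KfunE t φ ^ 2 = ⊤ := by
      intro t ht
      have ht : 0 < t := ht
      rw [P.KfunE_eq_top h, ENNReal.top_pow two_ne_zero, ENNReal.mul_top]
      simpa using Real.rpow_pos_of_pos ht _
    rw [setLIntegral_congr_fun measurableSet_Ioi this]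
    simp
  simpa using this

lemma mem_Kmem_iff {θ : ℝ} (h0 : 0 < θ) (h1 : θ < 1) {φ : V} :
    φ ∈ P.Kmem θ 2 ↔ P.Knorm2E θ φ < ⊤ := by
  have hc : ENNReal.ofReal √(2 / Real.pi * Real.sin (Real.pi * θ)) ≠ 0 := by
    simpa using sin_const_pos h0 h1
  constructor
  · rintro ⟨-, h⟩
    exact ENNReal.mul_lt_top ENNReal.ofReal_lt_top h
  · intro h
    refine ⟨by_contra fun h' => h.ne (P.Knorm2E_eq_top h0 h1 h'), ?_⟩
    exact ENNReal.lt_top_of_mul_ne_top_right h.ne hc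

lemma mem_KsetX_iff {θ : ℝ} (h : θ ∈ Icc (0 : ℝ) 1) {φ : V} :
    φ ∈ P.KsetX θ ↔ P.KnormX θ φ < ⊤ := by
  rw [KsetX, KnormX]
  split_ifs with h0 h1
  · exact P.norm0E_lt_top_iff.symm
  · exact P.norm1E_lt_top_iff.symm
  · exact P.mem_Kmem_iff (lt_of_le_of_ne h.1 (Ne.symm h0)) (lt_of_le_of_ne h.2 h1)

lemma KsetX_subset_sigmaSet (θ : ℝ) : P.KsetX θ ⊆ P.sigmaSet := by
  rw [KsetX]
  split_ifs
  · rintro _ ⟨a, rfl⟩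
    exact ⟨a, 0, by simp⟩
  · rintro _ ⟨a, rfl⟩
    exact ⟨0, a, by simp⟩
  · exact fun _ h => h.1

lemma KfunE_sq_le_of_norm_eq {Y0 Y1 : Type*}
    [NormedAddCommGroup Y0] [NormedSpace ℂ Y0] [CompleteSpace Y0]
    [NormedAddCommGroup Y1] [NormedSpace ℂ Y1] [CompleteSpace Y1]
    (Q : CompatiblePair V Y0 Y1) (h0 : ∀ φ, P.norm0E φ = Q.norm0E φ)
    (h1 : ∀ φ, P.norm1E φ = Q.norm1E φ) (t : ℝ) (φ : V) :
    P.KfunE t φ ^ 2 ≤ Q.KfunE t φ ^ 2 := by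
  refine Q.le_KfunE_sq ?_
  rintro a b rfl
  obtain ⟨a', ha⟩ : Q.j0 a ∈ range P.j0 := by
    rw [← norm0E_lt_top_iff, h0, norm0E_lt_top_iff]
    exact ⟨a, rfl⟩
  obtain ⟨b', hb⟩ : Q.j1 b ∈ range P.j1 := by
    rw [← norm1E_lt_top_iff, h1, norm1E_lt_top_iff]
    exact ⟨b, rfl⟩
  rw [← h0, ← h1, ← ha, ← hb]
  exact P.KfunE_sq_le t a' b'

lemma Knorm2E_congr {Y0 Y1 : Type*}
    [NormedAddCommGroup Y0] [NormedSpace ℂ Y0] [CompleteSpace Y0]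
    [NormedAddCommGroup Y1] [NormedSpace ℂ Y1] [CompleteSpace Y1]
    (Q : CompatiblePair V Y0 Y1) (h0 : ∀ φ, P.norm0E φ = Q.norm0E φ)
    (h1 : ∀ φ, P.norm1E φ = Q.norm1E φ) (θ : ℝ) (φ : V) :
    P.Knorm2E θ φ = Q.Knorm2E θ φ := by
  have h : P.Knorm2E θ φ ^ 2 = Q.Knorm2E θ φ ^ 2 := by
    rw [Knorm2E_sq, Knorm2E_sq]
    congr 2
    funext t
    rw [le_antisymm (P.KfunE_sq_le_of_norm_eq Q h0 h1 t φ)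
      (Q.KfunE_sq_le_of_norm_eq P (fun φ => (h0 φ).symm) (fun φ => (h1 φ).symm) t φ)]
  exact (ENNReal.pow_right_strictMono two_ne_zero).injective h

/-- The pair with the two components exchanged. -/
def swap : CompatiblePair V X1 X0 := ⟨P.j1, P.j0, P.inj1, P.inj0⟩

lemma ofReal_mul_KfunE_swap_le {t : ℝ} (ht : 0 < t) (φ : V) :
    P.swap.KfunE t φ ^ 2 ≤ ENNReal.ofReal (t ^ 2) * P.KfunE t⁻¹ φ ^ 2 := by
  have ht2 : ENNReal.ofReal (t ^ 2) ≠ 0 := by simpa using ht.ne'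
  rw [mul_comm, ← ENNReal.div_le_iff ht2 ENNReal.ofReal_ne_top]
  refine P.le_KfunE_sq ?_
  rintro a b rfl
  rw [ENNReal.div_le_iff ht2 ENNReal.ofReal_ne_top, add_mul, mul_right_comm,
    ← ENNReal.ofReal_mul (by positivity), inv_pow, inv_mul_cancel₀ (by positivity),
    ENNReal.ofReal_one, one_mul, add_comm (P.j0 a), add_comm (_ * _), mul_comm _ (ENNReal.ofReal _)]
  exact P.swap.KfunE_sq_le t b a

lemma KfunE_swap_sq {t : ℝ} (ht : 0 < t) (φ : V) :
    P.swap.KfunE t φ ^ 2 = ENNReal.ofReal (t ^ 2) * P.KfunE t⁻¹ φ ^ 2 := by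
  refine le_antisymm (P.ofReal_mul_KfunE_swap_le ht φ) ?_
  calc _ ≤ ENNReal.ofReal (t ^ 2) * (ENNReal.ofReal (t⁻¹ ^ 2) * P.swap.KfunE t⁻¹⁻¹ φ ^ 2) := by
        gcongr
        exact P.swap.ofReal_mul_KfunE_swap_le (inv_pos.2 ht) φ
    _ = _ := by
        rw [← mul_assoc, ← ENNReal.ofReal_mul (by positivity), inv_inv, inv_pow,
          mul_inv_cancel₀ (by positivity), ENNReal.ofReal_one, one_mul]

lemma Knorm2E_swap (θ : ℝ) (φ : V) : P.swap.Knorm2E θ φ = P.Knorm2E (1 - θ) φ := by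
  have h : P.swap.Knorm2E θ φ ^ 2 = P.Knorm2E (1 - θ) φ ^ 2 := by
    rw [Knorm2E_sq, Knorm2E_sq, mul_sub, mul_one, Real.sin_pi_sub]
    congr 1
    conv_rhs => rw [lintegral_Ioi_inv]
    refine setLIntegral_congr_fun measurableSet_Ioi fun t ht => ?_
    have ht : 0 < t := ht
    rw [P.KfunE_swap_sq ht, ← mul_assoc, ← mul_assoc, ← ENNReal.ofReal_mul (by positivity),
      ← ENNReal.ofReal_mul (by positivity)]
    congr 2
    rw [Real.inv_rpow ht.le, ← Real.rpow_natCast, ← Real.rpow_neg ht.le, ← Real.rpow_neg ht.le,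
      ← Real.rpow_add ht, ← Real.rpow_add ht]
    congr 1
    push_cast
    ring
  exact (ENNReal.pow_right_strictMono two_ne_zero).injective h

end CompatiblePair

section Diagonal

variable {S : Type*} [NormedAddCommGroup S] [InnerProductSpace ℂ S] [CompleteSpace S]
  {X : Type*} [TopologicalSpace X] [CompactSpace X] [T2Space X] (Φ : C(X, ℝ) →⋆ₐ[ℝ] (S →L[ℂ] S))

lemma invForm_starAlgHom_smul {c : ℝ} (hc : 0 < c) {g : C(X, ℝ)} (hg : 0 ≤ g) (s : S) :
    invForm (Φ (c⁻¹ • g)) s = ENNReal.ofReal c * invForm (Φ g) s := by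
  borelize X
  obtain ⟨μ, _, hμ⟩ := exists_spectralMeasure Φ s
  have hcg : 0 ≤ c⁻¹ • g := fun x => mul_nonneg (inv_nonneg.2 hc.le) (hg x)
  rw [invForm_starAlgHom_eq_lintegral Φ hμ hg, invForm_starAlgHom_eq_lintegral Φ hμ hcg,
    ← lintegral_const_mul' _ _ ENNReal.ofReal_ne_top]
  refine lintegral_congr fun x => ?_
  rw [ContinuousMap.smul_apply, smul_eq_mul, ENNReal.ofReal_mul (inv_nonneg.2 hc.le),
    ENNReal.ofReal_inv_of_pos hc, ENNReal.mul_inv, inv_inv]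
  · exact Or.inr ENNReal.ofReal_ne_top
  · exact Or.inl (ENNReal.inv_ne_top.2 (by simpa using hc))

namespace CompatiblePair

variable {V Y0 Y1 : Type*} [AddCommGroup V] [Module ℂ V]
  [NormedAddCommGroup Y0] [NormedSpace ℂ Y0] [CompleteSpace Y0]
  [NormedAddCommGroup Y1] [NormedSpace ℂ Y1] [CompleteSpace Y1]
  (Q : CompatiblePair V Y0 Y1)

lemma KfunE_sq_eq_invForm {J : S →ₗ[ℂ] V} (hJ : Function.Injective J)
    (hr0 : range Q.j0 ⊆ range J) (hr1 : range Q.j1 ⊆ range J)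
    {f g : C(X, ℝ)} (hf : 0 ≤ f) (hg : 0 ≤ g)
    (h0 : ∀ s, Q.norm0E (J s) ^ 2 = invForm (Φ f) s)
    (h1 : ∀ s, Q.norm1E (J s) ^ 2 = invForm (Φ g) s)
    {t : ℝ} (ht : 0 < t) (s : S) :
    Q.KfunE t (J s) ^ 2 = invForm (Φ (f + (t ^ 2)⁻¹ • g)) s := by
  have ht2 : 0 < t ^ 2 := by positivity
  have h1' : ∀ s, ENNReal.ofReal (t ^ 2) * Q.norm1E (J s) ^ 2 =
      invForm (Φ ((t ^ 2)⁻¹ • g)) s := fun s => by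
    rw [h1, invForm_starAlgHom_smul Φ ht2 hg]
  apply le_antisymm
  · by_cases htop : invForm (Φ (f + (t ^ 2)⁻¹ • g)) s = ⊤
    · rw [htop]; exact le_top
    have htg : 0 ≤ (t ^ 2)⁻¹ • g := fun x => mul_nonneg (inv_nonneg.2 ht2.le) (hg x)
    obtain ⟨s₀, s₁, hs, hle⟩ := exists_add_eq_of_invForm_starAlgHom Φ hf htg htop
    have hsum := hle.trans_lt (lt_top_iff_ne_top.2 htop)
    rw [← h0, ← h1'] at hsum hle
    obtain ⟨hl, hr⟩ := ENNReal.add_lt_top.1 hsum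
    obtain ⟨a, ha⟩ := Q.norm0E_lt_top_iff.1 (by simpa using hl)
    obtain ⟨b, hb⟩ := (Q.norm1E_lt_top_iff (φ := J s₁)).1 (by
      have := ENNReal.lt_top_of_mul_ne_top_right hr.ne (by simpa using ht.ne')
      simpa using this)
    rw [← ha, ← hb] at hle
    refine le_trans ?_ hle
    rw [← hs, map_add, ← ha, ← hb]
    exact Q.KfunE_sq_le t a b
  · refine Q.le_KfunE_sq fun a b hab => ?_
    obtain ⟨s₀, hs₀⟩ := hr0 ⟨a, rfl⟩
    obtain ⟨s₁, hs₁⟩ := hr1 ⟨b, rfl⟩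
    rw [← hs₀, ← hs₁, ← map_add] at hab
    rw [← hs₀, ← hs₁, h0, h1', ← hJ hab, map_add]
    exact invForm_add_le _ _ _ _

lemma Knorm2E_sq_eq_invForm {J : S →ₗ[ℂ] V} (hJ : Function.Injective J)
    (hr0 : range Q.j0 ⊆ range J) (hr1 : range Q.j1 ⊆ range J)
    {f g : C(X, ℝ)} (hf : 0 ≤ f) (hg : 0 ≤ g)
    (h0 : ∀ s, Q.norm0E (J s) ^ 2 = invForm (Φ f) s)
    (h1 : ∀ s, Q.norm1E (J s) ^ 2 = invForm (Φ g) s)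
    {η : ℝ} (hη0 : 0 < η) (hη1 : η < 1) {k : C(X, ℝ)}
    (hk : ∀ x, k x = f x ^ (1 - η) * g x ^ η) (s : S) :
    Q.Knorm2E η (J s) ^ 2 = invForm (Φ k) s := by
  borelize X
  obtain ⟨μ, _, hμ⟩ := exists_spectralMeasure Φ s
  have hk0 : 0 ≤ k := fun x => by
    change (0 : ℝ) ≤ k x
    rw [hk]
    exact mul_nonneg (Real.rpow_nonneg (hf x) _) (Real.rpow_nonneg (hg x) _)
  have hK : ∀ t ∈ Ioi (0 : ℝ), ENNReal.ofReal (t ^ (-2 * η - 1)) * Q.KfunE t (J s) ^ 2 =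
      ∫⁻ x, ENNReal.ofReal (t ^ (-2 * η - 1)) *
        (ENNReal.ofReal (f x + (t ^ 2)⁻¹ * g x))⁻¹ ∂μ := by
    intro t ht
    have htg : 0 ≤ f + (t ^ 2)⁻¹ • g :=
      fun x => add_nonneg (hf x) (mul_nonneg (inv_nonneg.2 (sq_nonneg t)) (hg x))
    rw [Q.KfunE_sq_eq_invForm Φ hJ hr0 hr1 hf hg h0 h1 ht,
      invForm_starAlgHom_eq_lintegral Φ hμ htg,
      lintegral_const_mul' _ _ ENNReal.ofReal_ne_top]
    rfl
  have hfm := f.continuous.measurable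
  have hgm := g.continuous.measurable
  rw [Knorm2E_sq, setLIntegral_congr_fun measurableSet_Ioi hK, lintegral_lintegral_swap (by
    refine Measurable.aemeasurable ?_
    have : Measurable fun p : ℝ × X => f p.2 + (p.1 ^ 2)⁻¹ * g p.2 := by fun_prop
    have h2 : Measurable fun p : ℝ × X => p.1 ^ (-2 * η - 1) := by fun_prop
    exact h2.ennreal_ofReal.mul this.ennreal_ofReal.inv),
    ← lintegral_const_mul' _ _ ENNReal.ofReal_ne_top, invForm_starAlgHom_eq_lintegral Φ hμ hk0]
  refine lintegral_congr fun x => ?_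
  have hfx : 0 ≤ f x := hf x
  have hgx : 0 ≤ g x := hg x
  rw [lintegral_rpow_div hη0 hη1 hfx hgx, hk]

end CompatiblePair

end Diagonal

namespace CompatiblePair

variable {V H0 H1 S : Type*} [AddCommGroup V] [Module ℂ V]
  [NormedAddCommGroup H0] [InnerProductSpace ℂ H0] [CompleteSpace H0]
  [NormedAddCommGroup H1] [InnerProductSpace ℂ H1] [CompleteSpace H1]
  [NormedAddCommGroup S] [InnerProductSpace ℂ S] [CompleteSpace S]
  (P : CompatiblePair V H0 H1)

lemma norm0E_sq_eq_invForm {J : S →ₗ[ℂ] V} (hJ : Function.Injective J) {i : H0 →L[ℂ] S}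
    (hi : ∀ a, J (i a) = P.j0 a) (s : S) :
    P.norm0E (J s) ^ 2 = invForm (i ∘L i.adjoint) s := by
  apply le_antisymm
  · by_cases h : invForm (i ∘L i.adjoint) s = ⊤
    · rw [h]; exact le_top
    obtain ⟨a, rfl, ha⟩ := exists_apply_eq_of_invForm i h
    rwa [hi, norm0E_j0, ← ENNReal.ofReal_pow (norm_nonneg a)]
  · by_cases h : J s ∈ range P.j0
    · obtain ⟨a, ha⟩ := h
      rw [← ha, norm0E_j0, ← ENNReal.ofReal_pow (norm_nonneg a)]
      rw [← hi] at ha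
      rw [← hJ ha]
      exact invForm_apply_le i a
    · rw [P.norm0E_eq_top h, ENNReal.top_pow two_ne_zero]
      exact le_top

/-- Reiteration for a pair whose sum is realised by a Hilbert space `S` such that the embeddings
of the two components jointly form a coisometry. -/
lemma Knorm2E_reiteration_of_coisometry {Y0 Y1 : Type*}
    [NormedAddCommGroup Y0] [NormedSpace ℂ Y0] [CompleteSpace Y0]
    [NormedAddCommGroup Y1] [NormedSpace ℂ Y1] [CompleteSpace Y1]
    (Q : CompatiblePair V Y0 Y1) {J : S →ₗ[ℂ] V} (hJ : Function.Injective J)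
    {i₀ : H0 →L[ℂ] S} {i₁ : H1 →L[ℂ] S}
    (hi₀ : ∀ a, J (i₀ a) = P.j0 a) (hi₁ : ∀ b, J (i₁ b) = P.j1 b)
    (hI : i₀ ∘L i₀.adjoint + i₁ ∘L i₁.adjoint = 1)
    {θ0 θ1 : ℝ} (hθ0 : θ0 ∈ Icc (0 : ℝ) 1) (hθ1 : θ1 ∈ Icc (0 : ℝ) 1)
    (hQ0 : ∀ φ, Q.norm0E φ = P.KnormX θ0 φ) (hQ1 : ∀ φ, Q.norm1E φ = P.KnormX θ1 φ)
    {η : ℝ} (hη0 : 0 < η) (hη1 : η < 1) (φ : V) :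
    Q.Knorm2E η φ = P.KnormX ((1 - η) * θ0 + η * θ1) φ := by
  have hθ : (1 - η) * θ0 + η * θ1 ∈ Icc (0 : ℝ) 1 :=
    convex_Icc (0 : ℝ) 1 hθ0 hθ1 (by linarith) hη0.le (by ring)
  have hσ : P.sigmaSet = range J := by
    ext x
    constructor
    · rintro ⟨a, b, rfl⟩
      exact ⟨i₀ a + i₁ b, by rw [map_add, hi₀, hi₁]⟩
    · rintro ⟨s, rfl⟩
      refine ⟨i₀.adjoint s, i₁.adjoint s, ?_⟩
      rw [← hi₀, ← hi₁, ← map_add]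
      exact congrArg J (DFunLike.congr_fun hI s)
  have hr0 : range Q.j0 ⊆ range J := fun x hx => by
    rw [← hσ]
    refine P.KsetX_subset_sigmaSet θ0 ((P.mem_KsetX_iff hθ0).2 ?_)
    rw [← hQ0]
    exact Q.norm0E_lt_top_iff.2 hx
  have hr1 : range Q.j1 ⊆ range J := fun x hx => by
    rw [← hσ]
    refine P.KsetX_subset_sigmaSet θ1 ((P.mem_KsetX_iff hθ1).2 ?_)
    rw [← hQ1]
    exact Q.norm1E_lt_top_iff.2 hx
  by_cases hφ : φ ∈ range J
  swap
  · have hP : P.KnormX ((1 - η) * θ0 + η * θ1) φ = ⊤ := by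
      by_contra h
      refine hφ (hσ ▸ P.KsetX_subset_sigmaSet _ ((P.mem_KsetX_iff hθ).2 (lt_top_iff_ne_top.2 h)))
    rw [hP]
    refine Q.Knorm2E_eq_top hη0 hη1 ?_
    rintro ⟨a, b, rfl⟩
    obtain ⟨s, hs⟩ := hr0 ⟨a, rfl⟩
    obtain ⟨u, hu⟩ := hr1 ⟨b, rfl⟩
    exact hφ ⟨s + u, by rw [map_add, hs, hu]⟩
  obtain ⟨s, rfl⟩ := hφ
  set A : S →L[ℂ] S := i₁ ∘L i₁.adjoint with hAdef
  have hA0 : 0 ≤ A := (ContinuousLinearMap.nonneg_iff_isPositive _).2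
    (ContinuousLinearMap.isPositive_self_comp_adjoint i₁)
  have hA : IsSelfAdjoint A := hA0.isSelfAdjoint
  let Φ : C(spectrum ℝ A, ℝ) →⋆ₐ[ℝ] (S →L[ℂ] S) := cfcHom hA
  let x₁ : C(spectrum ℝ A, ℝ) := (ContinuousMap.id ℝ).restrict (spectrum ℝ A)
  have hΦ₁ : Φ x₁ = A := cfcHom_id hA
  have hΦ₀ : Φ (1 - x₁) = i₀ ∘L i₀.adjoint := by
    rw [map_sub, map_one, hΦ₁, ← hI, add_sub_cancel_right]
  have hx₁ : 0 ≤ x₁ := (cfcHom_nonneg_iff hA).1 (by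
    change 0 ≤ Φ x₁
    rw [hΦ₁]; exact hA0)
  have hx₀ : 0 ≤ 1 - x₁ := (cfcHom_nonneg_iff hA).1 (by
    change 0 ≤ Φ (1 - x₁)
    rw [hΦ₀]
    exact (ContinuousLinearMap.nonneg_iff_isPositive _).2
      (ContinuousLinearMap.isPositive_self_comp_adjoint i₀))
  let r : ∀ θ ∈ Icc (0 : ℝ) 1, C(spectrum ℝ A, ℝ) := fun θ h =>
    ⟨fun x => (1 - x₁) x ^ (1 - θ) * x₁ x ^ θ,
      ((1 - x₁).continuous.rpow_const fun _ => Or.inr (by linarith [h.2])).mul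
        (x₁.continuous.rpow_const fun _ => Or.inr h.1)⟩
  have hr : ∀ θ h, 0 ≤ r θ h := fun θ h x =>
    mul_nonneg (Real.rpow_nonneg (hx₀ x) _) (Real.rpow_nonneg (hx₁ x) _)
  have hP0 : ∀ s, P.norm0E (J s) ^ 2 = invForm (Φ (1 - x₁)) s := fun s => by
    rw [hΦ₀, P.norm0E_sq_eq_invForm hJ hi₀]
  have hP1 : ∀ s, P.norm1E (J s) ^ 2 = invForm (Φ x₁) s := fun s => by
    rw [hΦ₁, hAdef]
    exact P.swap.norm0E_sq_eq_invForm hJ hi₁ s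
  have hPr0 : range P.j0 ⊆ range J := by
    rintro _ ⟨a, rfl⟩
    exact ⟨i₀ a, hi₀ a⟩
  have hPr1 : range P.j1 ⊆ range J := by
    rintro _ ⟨a, rfl⟩
    exact ⟨i₁ a, hi₁ a⟩
  have hPX : ∀ θ h, ∀ s, P.KnormX θ (J s) ^ 2 = invForm (Φ (r θ h)) s := by
    intro θ h s
    rw [KnormX]
    split_ifs with h0 h1
    · rw [hP0]
      congr 2
      ext x
      simp [r, h0]
    · rw [hP1]
      congr 2
      ext x
      simp [r, h1]
    · exact P.Knorm2E_sq_eq_invForm Φ hJ hPr0 hPr1 hx₀ hx₁ hP0 hP1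
        (lt_of_le_of_ne h.1 (Ne.symm h0)) (lt_of_le_of_ne h.2 h1) (fun _ => rfl) s
  have hfin : Q.Knorm2E η (J s) ^ 2 = P.KnormX ((1 - η) * θ0 + η * θ1) (J s) ^ 2 := by
    rw [hPX _ hθ]
    refine Q.Knorm2E_sq_eq_invForm Φ hJ hr0 hr1 (hr θ0 hθ0) (hr θ1 hθ1)
      (fun s => by rw [hQ0, hPX θ0 hθ0])
      (fun s => by rw [hQ1, hPX θ1 hθ1]) hη0 hη1 (fun x => ?_) s
    have e0 : 0 ≤ (1 - x₁) x := hx₀ x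
    have e1 : 0 ≤ x₁ x := hx₁ x
    have hη1' : 0 ≤ 1 - η := by linarith
    change (1 - x₁) x ^ (1 - ((1 - η) * θ0 + η * θ1)) * x₁ x ^ ((1 - η) * θ0 + η * θ1) =
      ((1 - x₁) x ^ (1 - θ0) * x₁ x ^ θ0) ^ (1 - η) * ((1 - x₁) x ^ (1 - θ1) * x₁ x ^ θ1) ^ η
    rw [Real.mul_rpow (by positivity) (by positivity), Real.mul_rpow (by positivity)
      (by positivity), ← Real.rpow_mul e0, ← Real.rpow_mul e0, ← Real.rpow_mul e1,
      ← Real.rpow_mul e1, mul_mul_mul_comm,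
      ← Real.rpow_add_of_nonneg e0 (mul_nonneg (by linarith [hθ0.2]) hη1')
        (mul_nonneg (by linarith [hθ1.2]) hη0.le),
      ← Real.rpow_add_of_nonneg e1 (mul_nonneg hθ0.1 hη1') (mul_nonneg hθ1.1 hη0.le)]
    congr 2 <;> ring
  exact (ENNReal.pow_right_strictMono two_ne_zero).injective hfin

end CompatiblePair

namespace CompatiblePair

variable {V H0 H1 : Type*} [AddCommGroup V] [Module ℂ V]
  [NormedAddCommGroup H0] [InnerProductSpace ℂ H0] [CompleteSpace H0]
  [NormedAddCommGroup H1] [InnerProductSpace ℂ H1] [CompleteSpace H1]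
  (P : CompatiblePair V H0 H1)

/-- The map `(a, b) ↦ a + b` from the Hilbert space sum of the two components. -/
def sumMap : WithLp 2 (H0 × H1) →ₗ[ℂ] V :=
  P.j0.coprod P.j1 ∘ₗ (WithLp.linearEquiv 2 ℂ (H0 × H1)).toLinearMap

lemma sumMap_apply (w : WithLp 2 (H0 × H1)) : P.sumMap w = P.j0 w.fst + P.j1 w.snd := rfl

lemma Knorm2E_reiteration_of_isClosed {Y0 Y1 : Type*}
    [NormedAddCommGroup Y0] [NormedSpace ℂ Y0] [CompleteSpace Y0]
    [NormedAddCommGroup Y1] [NormedSpace ℂ Y1] [CompleteSpace Y1]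
    (Q : CompatiblePair V Y0 Y1)
    (hN : IsClosed (LinearMap.ker P.sumMap : Set (WithLp 2 (H0 × H1))))
    {θ0 θ1 : ℝ} (hθ0 : θ0 ∈ Icc (0 : ℝ) 1) (hθ1 : θ1 ∈ Icc (0 : ℝ) 1)
    (hQ0 : ∀ φ, Q.norm0E φ = P.KnormX θ0 φ) (hQ1 : ∀ φ, Q.norm1E φ = P.KnormX θ1 φ)
    {η : ℝ} (hη0 : 0 < η) (hη1 : η < 1) (φ : V) :
    Q.Knorm2E η φ = P.KnormX ((1 - η) * θ0 + η * θ1) φ := by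
  set N : Submodule ℂ (WithLp 2 (H0 × H1)) := LinearMap.ker P.sumMap
  have : CompleteSpace N := hN.completeSpace_coe
  let e₀ : H0 →L[ℂ] WithLp 2 (H0 × H1) :=
    (WithLp.prodContinuousLinearEquiv 2 ℂ H0 H1).symm.toContinuousLinearMap ∘L
      ContinuousLinearMap.inl ℂ H0 H1
  let e₁ : H1 →L[ℂ] WithLp 2 (H0 × H1) :=
    (WithLp.prodContinuousLinearEquiv 2 ℂ H0 H1).symm.toContinuousLinearMap ∘L
      ContinuousLinearMap.inr ℂ H0 H1
  have hJproj : ∀ w : WithLp 2 (H0 × H1),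
      P.sumMap (Nᗮ.orthogonalProjectionOnto w) = P.sumMap w := by
    intro w
    have h : w - Nᗮ.orthogonalProjectionOnto w ∈ Nᗮᗮ :=
      Submodule.sub_starProjection_mem_orthogonal w
    rw [Submodule.orthogonal_orthogonal] at h
    have h' : P.sumMap (w - Nᗮ.orthogonalProjectionOnto w) = 0 := h
    rw [map_sub, sub_eq_zero] at h'
    exact h'.symm
  have hadj₀ : ∀ s : Nᗮ, (Nᗮ.orthogonalProjectionOnto ∘L e₀).adjoint s =
      (s : WithLp 2 (H0 × H1)).fst := by
    intro s
    refine ext_inner_right ℂ fun a => ?_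
    rw [ContinuousLinearMap.adjoint_inner_left]
    simp [e₀]
  have hadj₁ : ∀ s : Nᗮ, (Nᗮ.orthogonalProjectionOnto ∘L e₁).adjoint s =
      (s : WithLp 2 (H0 × H1)).snd := by
    intro s
    refine ext_inner_right ℂ fun a => ?_
    rw [ContinuousLinearMap.adjoint_inner_left]
    simp [e₁]
  refine P.Knorm2E_reiteration_of_coisometry (S := Nᗮ) Q (J := P.sumMap ∘ₗ Nᗮ.subtype)
    (i₀ := Nᗮ.orthogonalProjectionOnto ∘L e₀) (i₁ := Nᗮ.orthogonalProjectionOnto ∘L e₁)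
    ?_ ?_ ?_ ?_ hθ0 hθ1 hQ0 hQ1 hη0 hη1 φ
  · refine (injective_iff_map_eq_zero _).2 fun s hs => ?_
    have h1 : (s : WithLp 2 (H0 × H1)) ∈ N := hs
    have h2 := Submodule.inner_right_of_mem_orthogonal h1 s.2
    exact Subtype.ext (inner_self_eq_zero.1 h2)
  · intro a
    refine (hJproj (e₀ a)).trans ?_
    simp [sumMap_apply, e₀]
  · intro b
    refine (hJproj (e₁ b)).trans ?_
    simp [sumMap_apply, e₁]
  · ext1 s
    have h : e₀ (s : WithLp 2 (H0 × H1)).fst + e₁ (s : WithLp 2 (H0 × H1)).snd = s := by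
      apply (WithLp.linearEquiv 2 ℂ (H0 × H1)).injective
      ext <;> simp [e₀, e₁]
    change Nᗮ.orthogonalProjectionOnto (e₀ ((Nᗮ.orthogonalProjectionOnto ∘L e₀).adjoint s)) +
      Nᗮ.orthogonalProjectionOnto (e₁ ((Nᗮ.orthogonalProjectionOnto ∘L e₁).adjoint s)) = s
    rw [hadj₀, hadj₁, ← map_add, h]
    exact Submodule.orthogonalProjectionOnto_mem_subspace_eq_self s

/-- If `K_{θ,2}` has no nonzero element of norm zero, then the kernel of the sum map is
closed. -/
lemma isClosed_ker_sumMap {θ : ℝ} (h : ∀ φ, P.Knorm2E θ φ = 0 → φ = 0) :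
    IsClosed (LinearMap.ker P.sumMap : Set (WithLp 2 (H0 × H1))) := by
  refine isClosed_of_closure_subset fun w hw => h _ ?_
  have hK : ∀ t, P.KfunE t (P.sumMap w) ^ 2 = 0 := by
    intro t
    have hlim : Tendsto (fun v : WithLp 2 (H0 × H1) =>
        ENNReal.ofReal (‖w.fst - v.fst‖ ^ 2 + t ^ 2 * ‖w.snd - v.snd‖ ^ 2))
        (𝓝[LinearMap.ker P.sumMap] w) (𝓝 0) := by
      have hc : Continuous fun v : WithLp 2 (H0 × H1) =>
        ENNReal.ofReal (‖w.fst - v.fst‖ ^ 2 + t ^ 2 * ‖w.snd - v.snd‖ ^ 2) :=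
        ENNReal.continuous_ofReal.comp (by fun_prop)
      have := hc.tendsto w
      simp only [sub_self, norm_zero, ne_eq, OfNat.ofNat_ne_zero, not_false_eq_true, zero_pow,
        mul_zero, add_zero, ENNReal.ofReal_zero] at this
      exact this.mono_left nhdsWithin_le_nhds
    have := mem_closure_iff_nhdsWithin_neBot.1 hw
    refine le_antisymm (ge_of_tendsto hlim ?_) (zero_le)
    filter_upwards [self_mem_nhdsWithin] with v hv
    have hv' : P.sumMap v = 0 := hv
    have e : P.sumMap w = P.j0 (w.fst - v.fst) + P.j1 (w.snd - v.snd) := by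
      rw [← sub_zero (P.sumMap w), ← hv', ← map_sub, sumMap_apply]
      rfl
    rw [e]
    refine (P.KfunE_sq_le t _ _).trans_eq ?_
    rw [← P.ofReal_sqrt_sq_add, ← ENNReal.ofReal_pow (by positivity), Real.sq_sqrt (by positivity)]
  have h2 : P.Knorm2E θ (P.sumMap w) ^ 2 = 0 := by
    rw [Knorm2E_sq]
    simp only [hK, mul_zero, lintegral_zero]
  exact pow_eq_zero_iff two_ne_zero |>.1 h2

/-- The pair whose two components are both the first component of `P`. -/
def diag : CompatiblePair V H0 H0 := ⟨P.j0, P.j0, P.inj0, P.inj0⟩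

lemma isClosed_ker_sumMap_diag :
    IsClosed (LinearMap.ker P.diag.sumMap : Set (WithLp 2 (H0 × H0))) := by
  have : (LinearMap.ker P.diag.sumMap : Set (WithLp 2 (H0 × H0))) = {w | w.fst + w.snd = 0} := by
    ext w
    change P.j0 w.fst + P.j0 w.snd = 0 ↔ _
    rw [← map_add, map_eq_zero_iff _ P.inj0]
    rfl
  rw [this]
  exact isClosed_eq (by fun_prop) continuous_const

lemma norm0E_eq_KnormX {G : Type*} [NormedAddCommGroup G] [NormedSpace ℂ G] [CompleteSpace G]
    {Y : Type*} [NormedAddCommGroup Y] [NormedSpace ℂ Y] [CompleteSpace Y]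
    (Q : CompatiblePair V G Y) {θ : ℝ} (hθ : θ ∈ Icc (0 : ℝ) 1)
    (hr : range Q.j0 = P.KsetX θ) (hn : ∀ g, P.KnormX θ (Q.j0 g) = ENNReal.ofReal ‖g‖) (φ : V) :
    Q.norm0E φ = P.KnormX θ φ := by
  by_cases hφ : φ ∈ range Q.j0
  · obtain ⟨g, rfl⟩ := hφ
    rw [norm0E_j0, hn]
  · rw [Q.norm0E_eq_top hφ]
    rw [hr, P.mem_KsetX_iff hθ, not_lt, top_le_iff] at hφ
    exact hφ.symm

lemma eq_zero_of_norm0E_eq_zero {X Y : Type*}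
    [NormedAddCommGroup X] [NormedSpace ℂ X] [CompleteSpace X]
    [NormedAddCommGroup Y] [NormedSpace ℂ Y] [CompleteSpace Y]
    (Q : CompatiblePair V X Y) {φ : V} (h : Q.norm0E φ = 0) : φ = 0 := by
  obtain ⟨g, rfl⟩ := Q.norm0E_lt_top_iff.1 (h ▸ ENNReal.zero_lt_top)
  rw [norm0E_j0, ENNReal.ofReal_eq_zero] at h
  rw [norm_le_zero_iff.1 h, map_zero]

/-- Exact reiteration when the endpoint spaces have the prescribed norms. -/
lemma Knorm2E_reiteration {Y0 Y1 : Type*}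
    [NormedAddCommGroup Y0] [NormedSpace ℂ Y0] [CompleteSpace Y0]
    [NormedAddCommGroup Y1] [NormedSpace ℂ Y1] [CompleteSpace Y1]
    (Q : CompatiblePair V Y0 Y1) {θ0 θ1 : ℝ} (hθ0 : θ0 ∈ Icc (0 : ℝ) 1)
    (hθ1 : θ1 ∈ Icc (0 : ℝ) 1)
    (hQ0 : ∀ φ, Q.norm0E φ = P.KnormX θ0 φ) (hQ1 : ∀ φ, Q.norm1E φ = P.KnormX θ1 φ)
    {η : ℝ} (hη0 : 0 < η) (hη1 : η < 1) (φ : V) :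
    Q.Knorm2E η φ = P.KnormX ((1 - η) * θ0 + η * θ1) φ := by
  have hclosed : ∀ {θ : ℝ}, (∀ ψ, P.KnormX θ ψ = 0 → ψ = 0) → θ ≠ 0 → θ ≠ 1 →
      IsClosed (LinearMap.ker P.sumMap : Set (WithLp 2 (H0 × H1))) := fun {θ} h h0 h1 =>
    P.isClosed_ker_sumMap (θ := θ) fun ψ hψ => h ψ (by rw [KnormX, if_neg h0, if_neg h1, hψ])
  have hz0 : ∀ ψ, P.KnormX θ0 ψ = 0 → ψ = 0 := fun ψ hψ =>
    Q.eq_zero_of_norm0E_eq_zero ((hQ0 ψ).trans hψ)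
  have hz1 : ∀ ψ, P.KnormX θ1 ψ = 0 → ψ = 0 := fun ψ hψ =>
    Q.swap.eq_zero_of_norm0E_eq_zero ((hQ1 ψ).trans hψ)
  by_cases h00 : θ0 = 0
  · by_cases h10 : θ1 = 0
    · subst h00 h10
      have := P.diag.Knorm2E_reiteration_of_isClosed Q P.isClosed_ker_sumMap_diag hθ0 hθ1
        (fun φ => (hQ0 φ).trans (by simp [KnormX, norm0E, diag]))
        (fun φ => (hQ1 φ).trans (by simp [KnormX, norm0E, diag])) hη0 hη1 φ
      rw [this]
      simp [KnormX, norm0E, diag]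
    by_cases h11 : θ1 = 1
    · subst h00 h11
      rw [Q.Knorm2E_congr P (fun φ => (hQ0 φ).trans (by simp [KnormX]))
        (fun φ => (hQ1 φ).trans (by simp [KnormX]))]
      simp [KnormX, hη0.ne', hη1.ne]
    · exact P.Knorm2E_reiteration_of_isClosed Q (hclosed hz1 h10 h11) hθ0 hθ1 hQ0 hQ1
        hη0 hη1 φ
  by_cases h01 : θ0 = 1
  swap
  · exact P.Knorm2E_reiteration_of_isClosed Q (hclosed hz0 h00 h01) hθ0 hθ1 hQ0 hQ1 hη0 hη1 φ
  by_cases h10 : θ1 = 0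
  · subst h01 h10
    rw [Q.Knorm2E_congr P.swap (fun φ => (hQ0 φ).trans (by simp [KnormX, norm0E, norm1E, swap]))
      (fun φ => (hQ1 φ).trans (by simp [KnormX, norm0E, norm1E, swap])), Knorm2E_swap]
    have h1 : 1 - η ≠ 0 := by linarith
    simp [KnormX, hη0.ne', h1]
  by_cases h11 : θ1 = 1
  · subst h01 h11
    have h00' : (0 : ℝ) ∈ Icc (0 : ℝ) 1 := by simp
    have := P.swap.diag.Knorm2E_reiteration_of_isClosed Q P.swap.isClosed_ker_sumMap_diag h00' h00'
      (fun φ => (hQ0 φ).trans (by simp [KnormX, norm0E, norm1E, diag, swap]))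
      (fun φ => (hQ1 φ).trans (by simp [KnormX, norm0E, norm1E, diag, swap])) hη0 hη1 φ
    rw [this]
    simp [KnormX, norm0E, norm1E, diag, swap]
  · exact P.Knorm2E_reiteration_of_isClosed Q (hclosed hz1 h10 h11) hθ0 hθ1 hQ0 hQ1
      hη0 hη1 φ

end CompatiblePair

/-- (Theorem 3.7(i): exact reiteration.) Let `H̄ = (H0,H1)` be a
compatible pair of complex Hilbert spaces, `θ0, θ1 ∈ [0,1]`, and for `j = 0,1` let
`ℋ_j` be the Hilbert space `K_{θ_j,2}(H̄)` (interpreted as `H_{θ_j}` if `θ_j ∈ {0,1}`),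
realised by `(G_j, jG_j)`. Then `(ℋ0,ℋ1)` is a compatible pair (here: `Q`), and for
`0 < η < 1` and `θ = (1-η)θ0 + ηθ1`, `K_{η,2}((ℋ0,ℋ1)) = K_{θ,2}(H̄)` as sets, with
equality of norms. -/
theorem statement14
    {V H0 H1 : Type*} [AddCommGroup V] [Module ℂ V]
    [NormedAddCommGroup H0] [InnerProductSpace ℂ H0] [CompleteSpace H0]
    [NormedAddCommGroup H1] [InnerProductSpace ℂ H1] [CompleteSpace H1]
    (P : CompatiblePair V H0 H1)
    (θ0 θ1 : ℝ) (hθ0 : θ0 ∈ Set.Icc (0:ℝ) 1) (hθ1 : θ1 ∈ Set.Icc (0:ℝ) 1)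
    {G0 G1 : Type*}
    [NormedAddCommGroup G0] [InnerProductSpace ℂ G0] [CompleteSpace G0]
    [NormedAddCommGroup G1] [InnerProductSpace ℂ G1] [CompleteSpace G1]
    (jG0 : G0 →ₗ[ℂ] V) (jG1 : G1 →ₗ[ℂ] V)
    (h0 : Function.Injective jG0) (h1 : Function.Injective jG1)
    (hr0 : Set.range jG0 = P.KsetX θ0) (hr1 : Set.range jG1 = P.KsetX θ1)
    (hn0 : ∀ g : G0, P.KnormX θ0 (jG0 g) = ENNReal.ofReal ‖g‖)
    (hn1 : ∀ g : G1, P.KnormX θ1 (jG1 g) = ENNReal.ofReal ‖g‖)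
    (η : ℝ) (hη0 : 0 < η) (hη1 : η < 1) :
    (CompatiblePair.mk jG0 jG1 h0 h1).Kmem η 2 = P.KsetX ((1 - η) * θ0 + η * θ1) ∧
    ∀ φ ∈ (CompatiblePair.mk jG0 jG1 h0 h1).Kmem η 2,
      (CompatiblePair.mk jG0 jG1 h0 h1).Knorm2E η φ = P.KnormX ((1 - η) * θ0 + η * θ1) φ := by
  set Q := CompatiblePair.mk jG0 jG1 h0 h1
  have key := P.Knorm2E_reiteration Q hθ0 hθ1 (P.norm0E_eq_KnormX Q hθ0 hr0 hn0)
    (P.norm0E_eq_KnormX Q.swap hθ1 hr1 hn1) hη0 hη1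
  have hθ : (1 - η) * θ0 + η * θ1 ∈ Icc (0 : ℝ) 1 :=
    convex_Icc (0 : ℝ) 1 hθ0 hθ1 (by linarith) hη0.le (by ring)
  refine ⟨?_, fun φ _ => key φ⟩
  ext φ
  rw [Q.mem_Kmem_iff hη0 hη1, P.mem_KsetX_iff hθ, key]
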